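/- Let Γ₀ ≤ SO(2,1)⁰ be a Schottky group, and let u₁, u₂ : Γ₀ → ℝ³ be cocycles whose associated affine deformations act properly discontinuously on ℝ³ and which satisfy α_{u₁}(γ) > 0 and α_{u₂}(γ) > 0 for every nontrivial γ ∈ Γ₀. Then for all real numbers s, t > 0, the affine deformation associated to the cocycle s·u₁ + t·u₂ acts properly discontinuously on ℝ³. In other words, the properly discontinuous affine deformations with positive Margulis invariant form a convex cone in the space of cocycles. -/

import Mathlib

open Matrix

noncomputable section

/-- The Lorentzian bilinear form on `ℝ³`: `B(v,w) = v₁w₁ + v₂w₂ − v₃w₃`. -/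
def Bform (v w : Fin 3 → ℝ) : ℝ := v 0 * w 0 + v 1 * w 1 - v 2 * w 2

/-- `SO(2,1)⁰`: linear automorphisms of `ℝ³` preserving `B`, with determinant 1,
preserving the future cone `{v | B(v,v) < 0, v₃ > 0}`. -/
def SO21 (γ : Matrix (Fin 3) (Fin 3) ℝ) : Prop :=
  (∀ v w : Fin 3 → ℝ, Bform (γ.mulVec v) (γ.mulVec w) = Bform v w) ∧
  γ.det = 1 ∧
  (∀ v : Fin 3 → ℝ, Bform v v < 0 → 0 < v 2 → 0 < γ.mulVec v 2)

/-- A matrix is hyperbolic if it has an eigenvalue `λ > 1`. -/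
def IsHyperbolic (γ : Matrix (Fin 3) (Fin 3) ℝ) : Prop :=
  ∃ lam : ℝ, 1 < lam ∧ ∃ v : Fin 3 → ℝ, v ≠ 0 ∧ γ.mulVec v = lam • v

/-- `x0` is the neutral vector of `γ`: fixed by `γ`, of unit `B`-norm, and such that
`det(x₋, x⁰, x₊) > 0` for (any) future-pointing eigenvectors `x₋, x₊` of `γ` for the
eigenvalues `λ > 1` and `λ⁻¹`. -/
def IsNeutral (γ : Matrix (Fin 3) (Fin 3) ℝ) (x0 : Fin 3 → ℝ) : Prop :=
  γ.mulVec x0 = x0 ∧ Bform x0 x0 = 1 ∧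
  (∀ (lam : ℝ) (xm xp : Fin 3 → ℝ), 1 < lam → xm ≠ 0 → xp ≠ 0 →
    γ.mulVec xm = lam • xm → γ.mulVec xp = lam⁻¹ • xp →
    0 < xm 2 → 0 < xp 2 → 0 < (Matrix.of ![xm, x0, xp]).det)

/-- The underlying matrix of an element of a subgroup of `GL(3,ℝ)`. -/
def toM {Γ₀ : Subgroup (Matrix (Fin 3) (Fin 3) ℝ)ˣ} (γ : Γ₀) : Matrix (Fin 3) (Fin 3) ℝ :=
  ((γ : (Matrix (Fin 3) (Fin 3) ℝ)ˣ) : Matrix (Fin 3) (Fin 3) ℝ)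

/-- A Schottky group: a nonabelian discrete subgroup of `SO(2,1)⁰` all of whose
nontrivial elements are hyperbolic. -/
def IsSchottky (Γ₀ : Subgroup (Matrix (Fin 3) (Fin 3) ℝ)ˣ) : Prop :=
  (∀ γ : Γ₀, SO21 (toM γ)) ∧
  DiscreteTopology Γ₀ ∧
  (∃ a b : Γ₀, a * b ≠ b * a) ∧
  (∀ γ : Γ₀, γ ≠ 1 → IsHyperbolic (toM γ))

/-- A cocycle `u : Γ₀ → ℝ³`, i.e. `u(γ₁γ₂) = u(γ₁) + γ₁ u(γ₂)`. -/
def IsCocycle (Γ₀ : Subgroup (Matrix (Fin 3) (Fin 3) ℝ)ˣ) (u : Γ₀ → Fin 3 → ℝ) : Prop :=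
  ∀ γ₁ γ₂ : Γ₀, u (γ₁ * γ₂) = u γ₁ + (toM γ₁).mulVec (u γ₂)

/-- The affine deformation `γ·x = γx + u(γ)` acts properly discontinuously on `ℝ³`. -/
def ProperlyDisc (Γ₀ : Subgroup (Matrix (Fin 3) (Fin 3) ℝ)ˣ) (u : Γ₀ → Fin 3 → ℝ) : Prop :=
  ∀ K : Set (Fin 3 → ℝ), IsCompact K →
    {γ : Γ₀ | ∃ x ∈ K, (toM γ).mulVec x + u γ ∈ K}.Finite



abbrev M3 := Matrix (Fin 3) (Fin 3) ℝ

/-- explicit relations in SO(2,1) -/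
structure LRel (g : M3) : Prop where
  c00 : g 0 0 * g 0 0 + g 1 0 * g 1 0 - g 2 0 * g 2 0 = 1
  c11 : g 0 1 * g 0 1 + g 1 1 * g 1 1 - g 2 1 * g 2 1 = 1
  c22 : g 0 2 * g 0 2 + g 1 2 * g 1 2 - g 2 2 * g 2 2 = -1
  c01 : g 0 0 * g 0 1 + g 1 0 * g 1 1 - g 2 0 * g 2 1 = 0
  c02 : g 0 0 * g 0 2 + g 1 0 * g 1 2 - g 2 0 * g 2 2 = 0
  c12 : g 0 1 * g 0 2 + g 1 1 * g 1 2 - g 2 1 * g 2 2 = 0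
  r00 : g 0 0 * g 0 0 + g 0 1 * g 0 1 - g 0 2 * g 0 2 = 1
  r11 : g 1 0 * g 1 0 + g 1 1 * g 1 1 - g 1 2 * g 1 2 = 1
  r22 : g 2 0 * g 2 0 + g 2 1 * g 2 1 - g 2 2 * g 2 2 = -1
  r01 : g 0 0 * g 1 0 + g 0 1 * g 1 1 - g 0 2 * g 1 2 = 0
  r02 : g 0 0 * g 2 0 + g 0 1 * g 2 1 - g 0 2 * g 2 2 = 0
  r12 : g 1 0 * g 2 0 + g 1 1 * g 2 1 - g 1 2 * g 2 2 = 0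
  k00 : g 1 1 * g 2 2 - g 1 2 * g 2 1 = g 0 0
  k01 : g 1 2 * g 2 0 - g 1 0 * g 2 2 = g 0 1
  k02 : g 1 0 * g 2 1 - g 1 1 * g 2 0 = - g 0 2
  k10 : g 0 2 * g 2 1 - g 0 1 * g 2 2 = g 1 0
  k11 : g 0 0 * g 2 2 - g 0 2 * g 2 0 = g 1 1
  k12 : g 0 1 * g 2 0 - g 0 0 * g 2 1 = - g 1 2
  k20 : g 0 1 * g 1 2 - g 0 2 * g 1 1 = - g 2 0
  k21 : g 0 2 * g 1 0 - g 0 0 * g 1 2 = - g 2 1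
  k22 : g 0 0 * g 1 1 - g 0 1 * g 1 0 = g 2 2
  T1 : 1 ≤ g 2 2

def ginv (g : M3) : M3 :=
  !![g 0 0, g 1 0, - g 2 0; g 0 1, g 1 1, - g 2 1; - g 0 2, - g 1 2, g 2 2]

lemma ginv_mul {g : M3} (h : SO21 g) : ginv g * g = 1 := by
  have H := h.1
  have e (i j : Fin 3) := H (Pi.single i 1) (Pi.single j 1)
  simp only [Matrix.mulVec_single_one, Bform, Matrix.col_apply] at e
  have e00 := e 0 0
  have e01 := e 0 1
  have e02 := e 0 2
  have e11 := e 1 1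
  have e12 := e 1 2
  have e22 := e 2 2
  simp [Pi.single_apply] at e00 e01 e02 e11 e12 e22
  ext i j
  fin_cases i <;> fin_cases j <;> simp [ginv, Matrix.mul_apply, Fin.sum_univ_three] <;> linarith

lemma so_rel {g : M3} (h : SO21 g) : LRel g := by
  have h1 := ginv_mul h
  have h2 : g * ginv g = 1 := mul_eq_one_comm.mp h1
  have h3 : g.adjugate = ginv g := by
    have : g.adjugate * g = 1 := by rw [Matrix.adjugate_mul, h.2.1, one_smul]
    calc g.adjugate = g.adjugate * (g * ginv g) := by rw [h2, mul_one]
      _ = ginv g := by rw [← mul_assoc, this, one_mul]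
  have h4 := h.2.2 (Pi.single 2 1) (by simp [Bform]) (by simp)
  simp only [Matrix.mulVec_single_one, Matrix.col_apply] at h4
  rw [Matrix.adjugate_fin_three] at h3
  have e1 (i j : Fin 3) := congrFun (congrFun h1 i) j
  have e2 (i j : Fin 3) := congrFun (congrFun h2 i) j
  have e3 (i j : Fin 3) := congrFun (congrFun h3 i) j
  simp only [Matrix.mul_apply, Fin.sum_univ_three] at e1 e2
  have r22 := e2 2 2
  simp [ginv] at r22
  constructor
  case T1 => nlinarith [mul_self_nonneg (g 2 0), mul_self_nonneg (g 2 1)]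
  case c00 => have := e1 0 0; simp [ginv] at this; linarith
  case c01 => have := e1 0 1; simp [ginv] at this; linarith
  case c02 => have := e1 0 2; simp [ginv] at this; linarith
  case c11 => have := e1 1 1; simp [ginv] at this; linarith
  case c12 => have := e1 1 2; simp [ginv] at this; linarith
  case c22 => have := e1 2 2; simp [ginv] at this; linarith
  case r00 => have := e2 0 0; simp [ginv] at this; linarith
  case r01 => have := e2 0 1; simp [ginv] at this; linarith
  case r02 => have := e2 0 2; simp [ginv] at this; linarith
  case r11 => have := e2 1 1; simp [ginv] at this; linarith
  case r12 => have := e2 1 2; simp [ginv] at this; linarith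
  case r22 => linarith
  case k00 => have := e3 0 0; simp [ginv] at this; linarith
  case k10 => have := e3 0 1; simp [ginv] at this; linarith
  case k20 => have := e3 0 2; simp [ginv] at this; linarith
  case k01 => have := e3 1 0; simp [ginv] at this; linarith
  case k11 => have := e3 1 1; simp [ginv] at this; linarith
  case k21 => have := e3 1 2; simp [ginv] at this; linarith
  case k02 => have := e3 2 0; simp [ginv] at this; linarith
  case k12 => have := e3 2 1; simp [ginv] at this; linarith
  case k22 => have := e3 2 2; simp [ginv] at this; linarith

/-- unnormalised neutral vector -/
def xi (g : M3) : Fin 3 → ℝ := ![- g 2 1 - g 1 2, g 0 2 + g 2 0, g 1 0 - g 0 1]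

def tr3 (g : M3) : ℝ := g 0 0 + g 1 1 + g 2 2

/-- Lorentzian cross product -/
def lx (v w : Fin 3 → ℝ) : Fin 3 → ℝ :=
  ![v 1 * w 2 - v 2 * w 1, v 2 * w 0 - v 0 * w 2, - (v 0 * w 1 - v 1 * w 0)]

lemma xi_fix {g : M3} (h : LRel g) : g.mulVec (xi g) = xi g := by
  obtain ⟨⟩ := h
  ext i
  fin_cases i <;> simp [xi, Matrix.mulVec, dotProduct, Fin.sum_univ_three] <;> linarith

lemma B_xi {g : M3} (h : LRel g) : Bform (xi g) (xi g) = (tr3 g + 1) * (tr3 g - 3) := by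
  obtain ⟨⟩ := h
  simp [xi, Bform, tr3]
  linarith

lemma sub_ginv {g : M3} (v : Fin 3 → ℝ) : g.mulVec v - (ginv g).mulVec v = lx (xi g) v := by
  ext i
  fin_cases i <;> simp [xi, ginv, lx, Matrix.mulVec, dotProduct, Fin.sum_univ_three] <;> ring

lemma add_ginv {g : M3} (h : LRel g) :
    (tr3 g + 1) • (g + ginv g - (tr3 g - 1) • (1 : M3))
      = - (Matrix.vecMulVec (xi g) ![xi g 0, xi g 1, - xi g 2]) := by
  obtain ⟨⟩ := h
  ext i j
  fin_cases i <;> fin_cases j <;> simp [xi, ginv, tr3] <;> grind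

lemma sub_ginv_mat (g : M3) : g - ginv g
    = !![0, - xi g 2, xi g 1; xi g 2, 0, - xi g 0; xi g 1, - xi g 0, 0] := by
  ext i j
  fin_cases i <;> fin_cases j <;> simp [xi, ginv] <;> ring

/-- elements with parallel neutral vectors commute -/
lemma par_commute {a b : M3} (ha : LRel a) (hb : LRel b) (ta : 3 < tr3 a) (tb : 3 < tr3 b)
    (l : Fin 3 → ℝ) (p q : ℝ) (ea : xi a = p • l) (eb : xi b = q • l) : a * b = b * a := by
  have form : ∀ (g : M3) (r : ℝ), LRel g → 3 < tr3 g → xi g = r • l → ∃ x y z : ℝ,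
      g = x • (1 : M3) + y • Matrix.vecMulVec l ![l 0, l 1, - l 2]
        + z • !![0, - l 2, l 1; l 2, 0, - l 0; l 1, - l 0, 0] := by
    intro g r hg tg eg
    refine ⟨(tr3 g - 1) / 2, - r ^ 2 / (2 * (tr3 g + 1)), r / 2, ?_⟩
    have h1 := add_ginv hg
    have h2 := sub_ginv_mat g
    rw [eg] at h1 h2
    have hne : tr3 g + 1 ≠ 0 := by linarith
    ext i j
    have e1 := congrFun (congrFun h1 i) j
    have e2 := congrFun (congrFun h2 i) j
    have e3 : g i j = ((tr3 g + 1) * (g i j + ginv g i j) / (tr3 g + 1) + (g i j - ginv g i j)) / 2 := by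
      field_simp; ring
    simp only [Matrix.smul_apply, Matrix.sub_apply, Matrix.add_apply, smul_eq_mul] at e1 e2
    have e4 : (tr3 g + 1) * (g i j + ginv g i j) = (tr3 g + 1) * ((tr3 g - 1) * (1 : M3) i j) +
      (-vecMulVec (r • l) ![(r • l) 0, (r • l) 1, -(r • l) 2]) i j := by
        rw [← e1]; ring
    rw [e3, e4, e2]
    generalize tr3 g = t at *
    fin_cases i <;> fin_cases j <;> simp <;> field_simp <;> ring
  obtain ⟨x, y, z, h1⟩ := form a p ha ta ea
  obtain ⟨x', y', z', h2⟩ := form b q hb tb eb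
  rw [h1, h2]
  ext i j
  fin_cases i <;> fin_cases j <;> simp [Matrix.mul_apply, Fin.sum_univ_three] <;> ring

lemma tr_gt {g : M3} (h : LRel g) (hd : g.det = 1) (hh : IsHyperbolic g) : 3 < tr3 g := by
  obtain ⟨l, hl, v, hv, he⟩ := hh
  have h1 : (g - l • (1 : M3)).det = 0 := by
    apply Matrix.exists_mulVec_eq_zero_iff.mp
    exact ⟨v, hv, by simp [Matrix.sub_mulVec, Matrix.smul_mulVec, he]⟩
  have h2 : (l - 1) * (l * l - (tr3 g - 1) * l + 1) = 0 := by
    obtain ⟨⟩ := h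
    rw [Matrix.det_fin_three] at h1 hd
    simp at h1
    simp only [tr3]
    grind
  have h3 : l * l - (tr3 g - 1) * l + 1 = 0 := by
    rcases mul_eq_zero.mp h2 with h | h
    · linarith
    · exact h
  nlinarith [mul_pos (sub_pos.mpr hl) (sub_pos.mpr hl)]

lemma lx_zero {v w : Fin 3 → ℝ} (hv : v ≠ 0) (h : lx v w = 0) : ∃ c : ℝ, w = c • v := by
  have h0 := congrFun h 0
  have h1 := congrFun h 1
  have h2 := congrFun h 2
  simp [lx] at h0 h1 h2
  obtain ⟨i, hi⟩ := Function.ne_iff.mp hv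
  refine ⟨w i / v i, ?_⟩
  ext j
  simp at hi
  fin_cases i <;> fin_cases j <;> simp at hi ⊢ <;> field_simp <;> linarith

lemma neutral {g : M3} (h : SO21 g) (hh : IsHyperbolic g) :
    ∃ r : ℝ, 0 < r ∧ IsNeutral g (r • xi g) := by
  have R := so_rel h
  have ht := tr_gt R h.2.1 hh
  have hB := B_xi R
  have hp : 0 < Bform (xi g) (xi g) := by rw [hB]; apply mul_pos <;> linarith
  set b := Bform (xi g) (xi g) with hb
  have hs : 0 < Real.sqrt b := Real.sqrt_pos.mpr hp
  refine ⟨(Real.sqrt b)⁻¹, inv_pos.mpr hs, ?_, ?_, ?_⟩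
  · rw [Matrix.mulVec_smul, xi_fix R]
  · have : Bform ((Real.sqrt b)⁻¹ • xi g) ((Real.sqrt b)⁻¹ • xi g) = (Real.sqrt b)⁻¹ ^ 2 * b := by
      rw [hb]; simp only [Bform, Pi.smul_apply, smul_eq_mul]; ring
    rw [this, inv_pow, Real.sq_sqrt hp.le, inv_mul_cancel₀ hp.ne']
  · intro l xm xp hl hm hpn em ep m2 p2
    have hl0 : 0 < l := by linarith
    have nullm : Bform xm xm = 0 := by
      have := h.1 xm xm
      rw [em] at this
      have h2 : Bform (l • xm) (l • xm) = l ^ 2 * Bform xm xm := by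
        simp only [Bform, Pi.smul_apply, smul_eq_mul]; ring
      rw [h2] at this
      have h3 : (l - 1) * (l + 1) * Bform xm xm = 0 := by linear_combination this
      rcases mul_eq_zero.mp h3 with h4 | h4
      · exfalso; have : 0 < (l - 1) * (l + 1) := by apply mul_pos <;> linarith
        linarith
      · exact h4
    have ep' : xp = l • g.mulVec xp := by
      rw [ep, smul_smul, mul_inv_cancel₀ hl0.ne', one_smul]
    have nullp : Bform xp xp = 0 := by
      have := h.1 xp xp
      have h2 : Bform xp xp = l ^ 2 * Bform (g.mulVec xp) (g.mulVec xp) := by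
        conv_lhs => rw [ep']
        simp only [Bform, Pi.smul_apply, smul_eq_mul]; ring
      rw [this] at h2
      have h3 : (l - 1) * (l + 1) * Bform xp xp = 0 := by linear_combination -h2
      rcases mul_eq_zero.mp h3 with h4 | h4
      · exfalso; have : 0 < (l - 1) * (l + 1) := by apply mul_pos <;> linarith
        linarith
      · exact h4
    have im : (ginv g).mulVec xm = l⁻¹ • xm := by
      have : (ginv g).mulVec (g.mulVec xm) = xm := by
        rw [Matrix.mulVec_mulVec, ginv_mul h, Matrix.one_mulVec]
      rw [em, Matrix.mulVec_smul] at this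
      rw [← this, smul_smul, inv_mul_cancel₀ hl0.ne', one_smul, this]
    have hx := sub_ginv (g := g) xm
    rw [em, im] at hx
    have hBmp : Bform xm xp < 0 := by
      -- nonparallel
      by_contra hcon
      push Not at hcon
      have key : xp 2 • xm = xm 2 • xp := by
        have a1 : (xp 2 * xm 0 - xm 2 * xp 0)^2 + (xp 2 * xm 1 - xm 2 * xp 1)^2 
            = - 2 * xm 2 * xp 2 * Bform xm xp := by
          simp only [Bform] at nullm nullp ⊢
          linear_combination (xp 2)^2 * nullm + (xm 2)^2 * nullp
        have a2 : 0 ≤ xm 2 * xp 2 * Bform xm xp := by positivity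
        have b0 : xp 2 * xm 0 - xm 2 * xp 0 = 0 := by
          apply pow_eq_zero_iff (two_ne_zero) |>.mp
          nlinarith [sq_nonneg (xp 2 * xm 0 - xm 2 * xp 0), sq_nonneg (xp 2 * xm 1 - xm 2 * xp 1)]
        have b1 : xp 2 * xm 1 - xm 2 * xp 1 = 0 := by
          apply pow_eq_zero_iff (two_ne_zero) |>.mp
          nlinarith [sq_nonneg (xp 2 * xm 0 - xm 2 * xp 0), sq_nonneg (xp 2 * xm 1 - xm 2 * xp 1)]
        ext i
        fin_cases i <;> simp <;> linarith
      have k2 := congrArg g.mulVec key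
      rw [Matrix.mulVec_smul, Matrix.mulVec_smul, em, ep] at k2
      have k3 := congrFun k2 2
      simp at k3
      have h5 : l = l⁻¹ := by
        have : (l - l⁻¹) * (xp 2 * xm 2) = 0 := by linear_combination k3
        rcases mul_eq_zero.mp this with h | h
        · linarith
        · exact absurd h (by positivity)
      have : l⁻¹ < 1 := inv_lt_one_of_one_lt₀ hl
      linarith
    have x0 := congrFun hx 0
    have x1 := congrFun hx 1
    have x2 := congrFun hx 2
    simp [lx] at x0 x1 x2
    have hdet : (Matrix.of ![xm, (Real.sqrt b)⁻¹ • xi g, xp]).det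
        = (Real.sqrt b)⁻¹ * (- (l - l⁻¹) * Bform xm xp) := by
      rw [Matrix.det_fin_three]
      simp [Bform]
      linear_combination (-(Real.sqrt b)⁻¹) * (-(xp 0) * x0 - xp 1 * x1 + xp 2 * x2)
    rw [hdet]
    have : l⁻¹ < 1 := inv_lt_one_of_one_lt₀ hl
    apply mul_pos (inv_pos.mpr hs)
    nlinarith

section grp
variable {Γ₀ : Subgroup M3ˣ}

lemma toM_mul (a b : Γ₀) : toM (a * b) = toM a * toM b := rfl
lemma toM_one : toM (1 : Γ₀) = 1 := rfl
lemma toM_inj {a b : Γ₀} (h : toM a = toM b) : a = b := Subtype.ext (Units.ext h)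

lemma toM_inv (a : Γ₀) (h : SO21 (toM a)) : toM a⁻¹ = ginv (toM a) := by
  have h1 : toM a * toM a⁻¹ = 1 := by rw [← toM_mul, mul_inv_cancel, toM_one]
  calc toM a⁻¹ = (ginv (toM a) * toM a) * toM a⁻¹ := by rw [ginv_mul h, one_mul]
    _ = _ := by rw [mul_assoc, h1, mul_one]

lemma xi_ne {g : M3} (h : LRel g) (t : 3 < tr3 g) : xi g ≠ 0 := by
  intro h0
  have := B_xi h
  rw [h0] at this
  simp [Bform] at this
  rcases this with h | h <;> linarith

lemma noLine (hS : IsSchottky Γ₀) (l : Fin 3 → ℝ) (hl : l ≠ 0)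
    (hinv : ∀ g : Γ₀, ∃ c : ℝ, (toM g).mulVec l = c • l) : False := by
  obtain ⟨hso, -, ⟨a, b, hab⟩, hh⟩ := hS
  have tr (g : Γ₀) (hg : g ≠ 1) : 3 < tr3 (toM g) := tr_gt (so_rel (hso g)) (hso g).2.1 (hh g hg)
  have cancel (g : Γ₀) (v : Fin 3 → ℝ) : (toM g⁻¹).mulVec ((toM g).mulVec v) = v := by
    rw [Matrix.mulVec_mulVec, ← toM_mul, inv_mul_cancel, toM_one, Matrix.one_mulVec]
  obtain ⟨c, hc⟩ : ∃ c : Γ₀, c = a * b * a⁻¹ * b⁻¹ := ⟨_, rfl⟩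
  have hc1 : c ≠ 1 := by
    intro h
    apply hab
    have : a * b = c * (b * a) := by rw [hc]; group
    rw [this, h, one_mul]
  have hcl : (toM c⁻¹).mulVec l = l ∧ (toM c).mulVec l = l := by
    obtain ⟨x, hx⟩ := hinv a
    obtain ⟨y, hy⟩ := hinv b
    obtain ⟨z, hz⟩ := hinv c
    have h1 : (toM (a * b)).mulVec l = (x * y) • l := by
      rw [toM_mul, ← Matrix.mulVec_mulVec, hy, Matrix.mulVec_smul, hx, smul_smul, mul_comm]
    have h2 : (toM (c * (b * a))).mulVec l = (x * y * z) • l := by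
      rw [toM_mul, toM_mul, ← Matrix.mulVec_mulVec, ← Matrix.mulVec_mulVec, hx, Matrix.mulVec_smul,
        hy, Matrix.mulVec_smul, Matrix.mulVec_smul, hz, smul_smul, smul_smul, mul_assoc]
    have : a * b = c * (b * a) := by rw [hc]; group
    rw [← this, h1] at h2
    have hxy : x * y ≠ 0 := by
      intro h0
      rw [h0, zero_smul] at h1
      have := cancel (a * b) l
      rw [h1, Matrix.mulVec_zero] at this
      exact hl this.symm
    have h3 : x * y = x * y * z := smul_left_injective ℝ hl h2
    have hz1 : z = 1 := by
      apply mul_left_cancel₀ hxy; linarith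
    rw [hz1, one_smul] at hz
    refine ⟨?_, hz⟩
    have := cancel c l
    rwa [hz] at this
  have hBl : 0 < Bform l l := by
    have h1 := sub_ginv (g := toM c) l
    rw [← toM_inv c (hso c), hcl.1, hcl.2, sub_self] at h1
    obtain ⟨k, hk⟩ := lx_zero (xi_ne (so_rel (hso c)) (tr c hc1)) h1.symm
    have h2 := B_xi (so_rel (hso c))
    have h3 : Bform l l = k ^ 2 * Bform (xi (toM c)) (xi (toM c)) := by
      rw [hk]; simp only [Bform, Pi.smul_apply, smul_eq_mul]; ring
    have hk0 : k ≠ 0 := by rintro rfl; exact hl (by rw [hk, zero_smul])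
    rw [h3, h2]
    have := tr c hc1
    have : 0 < k ^ 2 := by positivity
    apply mul_pos this
    apply mul_pos <;> linarith
  have par (g : Γ₀) : ∃ k : ℝ, xi (toM g) = k • l := by
    obtain ⟨x, hx⟩ := hinv g
    have h1 := (hso g).1 l l
    rw [hx] at h1
    have h2 : Bform (x • l) (x • l) = x ^ 2 * Bform l l := by
      simp only [Bform, Pi.smul_apply, smul_eq_mul]; ring
    have h3 : x * x = 1 := by
      rw [h2] at h1
      have : (x * x - 1) * Bform l l = 0 := by linear_combination h1
      rcases mul_eq_zero.mp this with h | h <;> linarith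
    have h4 : (toM g⁻¹).mulVec l = x • l := by
      have := cancel g l
      rw [hx, Matrix.mulVec_smul] at this
      rw [← one_smul ℝ ((toM g⁻¹).mulVec l), ← h3, mul_smul, this]
    have h5 := sub_ginv (g := toM g) l
    rw [← toM_inv g (hso g), hx, h4, sub_self] at h5
    apply lx_zero hl
    have : lx l (xi (toM g)) = - lx (xi (toM g)) l := by
      ext i; fin_cases i <;> simp [lx] <;> ring
    rw [this, ← h5, neg_zero]
  obtain ⟨p, hp⟩ := par a
  obtain ⟨q, hq⟩ := par b
  have ha : a ≠ 1 := by rintro rfl; simp at hab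
  have hb : b ≠ 1 := by rintro rfl; simp at hab
  exact hab (toM_inj (par_commute (so_rel (hso a)) (so_rel (hso b)) (tr a ha) (tr b hb) l p q hp hq))

lemma perp2 {k v w : Fin 3 → ℝ} (h1 : Bform k v = 0) (h2 : Bform k w = 0) :
    lx (lx v w) k = 0 := by
  simp only [Bform] at h1 h2
  ext i
  fin_cases i <;> simp [lx]
  · linear_combination v 0 * h2 - w 0 * h1
  · linear_combination v 1 * h2 - w 1 * h1
  · linear_combination v 2 * h2 - w 2 * h1

lemma irr (hS : IsSchottky Γ₀) (v k : Fin 3 → ℝ) (hv : v ≠ 0) (hk : k ≠ 0) :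
    ∃ g : Γ₀, Bform k ((toM g).mulVec v) ≠ 0 := by
  by_contra hcon
  push Not at hcon
  have hso := hS.1
  apply noLine hS v hv
  intro g0
  by_contra hg0
  set w := (toM g0).mulVec v with hw
  have hn : lx v w ≠ 0 := fun h => hg0 (lx_zero hv h)
  apply noLine hS k hk
  have hk1 := hcon 1
  rw [toM_one, Matrix.one_mulVec] at hk1
  obtain ⟨x, hx⟩ := lx_zero hn (perp2 hk1 (hcon g0))
  have hx0 : x ≠ 0 := by rintro rfl; exact hk (by rw [hx, zero_smul])
  intro g
  have mv (p : Fin 3 → ℝ) : Bform ((toM g).mulVec k) p = Bform k ((toM g⁻¹).mulVec p) := by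
    rw [← (hso g).1 k, Matrix.mulVec_mulVec, ← toM_mul, mul_inv_cancel, toM_one, Matrix.one_mulVec]
  obtain ⟨y, hy⟩ := lx_zero (v := lx v w) (w := (toM g).mulVec k) hn (by
    apply perp2
    · rw [mv]; exact hcon _
    · rw [mv, hw, Matrix.mulVec_mulVec, ← toM_mul]; exact hcon _)
  refine ⟨y / x, ?_⟩
  rw [hy]
  conv_rhs => rw [hx]
  rw [smul_smul, div_mul_cancel₀ _ hx0]

lemma spanTop (hS : IsSchottky Γ₀) (v : Fin 3 → ℝ) (hv : v ≠ 0) :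
    Submodule.span ℝ (Set.range fun g : Γ₀ => (toM g).mulVec v) = ⊤ := by
  by_contra hcon
  obtain ⟨f, hf, hle⟩ := Submodule.exists_le_ker_of_lt_top _ (lt_top_iff_ne_top.mpr hcon)
  have hfv (p : Fin 3 → ℝ) : f p = Bform ![f (Pi.single 0 1), f (Pi.single 1 1), - f (Pi.single 2 1)] p := by
    rw [LinearMap.pi_apply_eq_sum_univ f p]
    have : ∀ i : Fin 3, (fun j => if i = j then (1:ℝ) else 0) = Pi.single i 1 := by
      intro i; ext j; simp [Pi.single_apply, eq_comm]
    simp only [this]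
    simp [Fin.sum_univ_three, Bform]
    ring
  obtain ⟨g, hg⟩ := irr hS v ![f (Pi.single 0 1), f (Pi.single 1 1), - f (Pi.single 2 1)] hv (by
    intro h
    apply hf
    ext p
    rw [h] at hfv
    simp [hfv, Bform])
  rw [← hfv] at hg
  exact hg (hle (Submodule.subset_span ⟨g, rfl⟩))

lemma single_mem (hS : IsSchottky Γ₀) (i j : Fin 3) :
    Matrix.single i j (1:ℝ) ∈ Submodule.span ℝ (Set.range fun g : Γ₀ => toM g) := by
  set A := Submodule.span ℝ (Set.range fun g : Γ₀ => toM g) with hA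
  have hso := hS.1
  have mem (g : Γ₀) : toM g ∈ A := Submodule.subset_span ⟨g, rfl⟩
  have lmul (g : Γ₀) : ∀ m ∈ A, toM g * m ∈ A := by
    intro m hm
    induction hm using Submodule.span_induction with
    | mem x h => obtain ⟨y, rfl⟩ := h; exact mem (g * y)
    | zero => simp
    | add x y _ _ h1 h2 => rw [mul_add]; exact A.add_mem h1 h2
    | smul c x _ h => rw [Matrix.mul_smul]; exact A.smul_mem c h
  have rmul (g : Γ₀) : ∀ m ∈ A, m * toM g ∈ A := by
    intro m hm
    induction hm using Submodule.span_induction with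
    | mem x h => obtain ⟨y, rfl⟩ := h; exact mem (y * g)
    | zero => simp
    | add x y _ _ h1 h2 => rw [add_mul]; exact A.add_mem h1 h2
    | smul c x _ h => rw [Matrix.smul_mul]; exact A.smul_mem c h
  have hS' := hS
  obtain ⟨-, -, ⟨a, b, hab⟩, hh⟩ := hS
  have ha : a ≠ 1 := by rintro rfl; simp at hab
  have ra := so_rel (hso a)
  have ta := tr_gt ra (hso a).2.1 (hh a ha)
  set v := xi (toM a) with hvdef
  have hv : v ≠ 0 := xi_ne ra ta
  let D : (Fin 3 → ℝ) → (Fin 3 → ℝ) := fun p => ![p 0, p 1, - p 2]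
  have base : Matrix.vecMulVec v (D v) ∈ A := by
    have h1 := add_ginv ra
    rw [← neg_mem_iff, ← h1, ← toM_inv a (hso a)]
    apply A.smul_mem
    apply A.sub_mem (A.add_mem (mem _) (mem _))
    apply A.smul_mem
    exact mem 1
  have step (p q : Fin 3 → ℝ) : Matrix.vecMulVec p (D q) ∈ A := by
    have hp : p ∈ Submodule.span ℝ (Set.range fun g : Γ₀ => (toM g).mulVec v) := by
      rw [spanTop hS' v hv]; trivial
    have hq : q ∈ Submodule.span ℝ (Set.range fun g : Γ₀ => (toM g).mulVec v) := by
      rw [spanTop hS' v hv]; trivial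
    have Dadd (x y) : D (x + y) = D x + D y := by
      ext i; fin_cases i <;> simp [D]; ring
    have Dsmul (c : ℝ) (x) : D (c • x) = c • D x := by
      ext i; fin_cases i <;> simp [D]
    have D0 : D 0 = 0 := by
      ext i; fin_cases i <;> simp [D]
    induction hp using Submodule.span_induction with
    | mem x h =>
      obtain ⟨g, rfl⟩ := h
      induction hq using Submodule.span_induction with
      | mem y h =>
        obtain ⟨k, rfl⟩ := h
        have e : Matrix.vecMulVec ((toM g).mulVec v) (D ((toM k).mulVec v)) =
            toM g * (Matrix.vecMulVec v (D v) * toM k⁻¹) := by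
          rw [Matrix.vecMulVec_mul, Matrix.mul_vecMulVec, toM_inv k (hso k)]
          congr 1
          ext i
          fin_cases i <;>
            simp [D, ginv, Matrix.mulVec, Matrix.vecMul, dotProduct, Fin.sum_univ_three] <;> ring
        simp only [e]
        exact lmul _ _ (rmul _ _ base)
      | zero => rw [D0]; simp
      | add x y _ _ h1 h2 => rw [Dadd, Matrix.vecMulVec_add]; exact A.add_mem h1 h2
      | smul c x _ h => rw [Dsmul, Matrix.vecMulVec_smul]; exact A.smul_mem c h
    | zero => simp
    | add x y _ _ h1 h2 => rw [Matrix.add_vecMulVec]; exact A.add_mem h1 h2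
    | smul c x _ h => rw [Matrix.smul_vecMulVec]; exact A.smul_mem c h
  have := step (Pi.single i 1) (D (Pi.single j 1))
  have hDD : D (D (Pi.single j 1)) = Pi.single j 1 := by
    ext i; fin_cases i <;> simp [D]
  rw [hDD] at this
  rwa [Matrix.single_eq_single_vecMulVec_single] 

end grp

lemma entry_le {g : M3} (h : LRel g) (i j : Fin 3) : |g i j| ≤ g 2 2 := by
  obtain ⟨⟩ := h
  apply abs_le_of_sq_le_sq _ (by linarith)
  have s (i j : Fin 3) := mul_self_nonneg (g i j)
  have := s 0 0
  have := s 0 1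
  have := s 0 2
  have := s 1 0
  have := s 1 1
  have := s 1 2
  have := s 2 0
  have := s 2 1
  fin_cases i <;> fin_cases j <;> simp [sq] <;> linarith

lemma lin_bound {g : M3} (h : LRel g) (w : Fin 3 → ℝ) (C : ℝ) (hC : 0 ≤ C)
    (hw : ∀ i j, |Bform w (xi (g * Matrix.single i j 1))| ≤ C * g 2 2) :
    ∃ x y : Fin 3 → ℝ, ‖x‖ ≤ 12 * C ∧ ‖y‖ ≤ 12 * C ∧ w = y + g.mulVec x := by
  have ent := entry_le h
  have q0 (i : Fin 3) : |w 1 * g 2 i - w 2 * g 1 i| ≤ C * g 2 2 := by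
    convert hw i 0 using 2
    simp [Bform, xi, Matrix.mul_apply, Matrix.single_apply]
  have q1 (i : Fin 3) : |w 0 * g 2 i - w 2 * g 0 i| ≤ C * g 2 2 := by
    rw [abs_sub_comm]
    convert hw i 1 using 2
    simp [Bform, xi, Matrix.mul_apply, Matrix.single_apply]
    ring
  have q2 (i : Fin 3) : |w 1 * g 0 i - w 0 * g 1 i| ≤ C * g 2 2 := by
    convert hw i 2 using 2
    simp [Bform, xi, Matrix.mul_apply, Matrix.single_apply]; ring
  have hT : 1 ≤ g 2 2 := h.T1
  have hT0 : 0 < g 2 2 := by linarith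
  by_cases h2 : g 2 2 < 2
  · refine ⟨0, w, by simp; positivity, ?_, by simp⟩
    have pr (x y : ℝ) (hx : |x| ≤ g 2 2) (hy : |y| ≤ C * g 2 2) : |x * y| ≤ 4 * C := by
      rw [abs_mul]
      calc |x| * |y| ≤ 2 * (C * 2) := by
            apply mul_le_mul (by linarith) (by nlinarith) (abs_nonneg _) (by norm_num)
        _ = 4 * C := by ring
    have tri (a b c : ℝ) (ha : |a| ≤ 4 * C) (hb : |b| ≤ 4 * C) (hc : |c| ≤ 4 * C) :
        |a - b - c| ≤ 12 * C := by
      rw [abs_le] at *; constructor <;> linarith [ha.1, ha.2, hb.1, hb.2, hc.1, hc.2]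
    rw [pi_norm_le_iff_of_nonneg (by positivity)]
    have e0 : w 0 = g 2 2 * (w 0 * g 2 2 - w 2 * g 0 2) - g 2 0 * (w 0 * g 2 0 - w 2 * g 0 0)
        - g 2 1 * (w 0 * g 2 1 - w 2 * g 0 1) := by
      linear_combination w 0 * h.r22 - w 2 * h.r02
    have e1 : w 1 = g 2 2 * (w 1 * g 2 2 - w 2 * g 1 2) - g 2 0 * (w 1 * g 2 0 - w 2 * g 1 0)
        - g 2 1 * (w 1 * g 2 1 - w 2 * g 1 1) := by
      linear_combination w 1 * h.r22 - w 2 * h.r12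
    have e2 : w 2 = g 0 2 * (w 0 * g 2 2 - w 2 * g 0 2) - g 0 0 * (w 0 * g 2 0 - w 2 * g 0 0)
        - g 0 1 * (w 0 * g 2 1 - w 2 * g 0 1) := by
      linear_combination - w 2 * h.r00 + w 0 * h.r02
    intro i
    rw [Real.norm_eq_abs]
    fin_cases i
    · show |w 0| ≤ _
      rw [e0]
      exact tri _ _ _ (pr _ _ (ent _ _) (q1 _)) (pr _ _ (ent _ _) (q1 _)) (pr _ _ (ent _ _) (q1 _))
    · show |w 1| ≤ _
      rw [e1]
      exact tri _ _ _ (pr _ _ (ent _ _) (q0 _)) (pr _ _ (ent _ _) (q0 _)) (pr _ _ (ent _ _) (q0 _))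
    · show |w 2| ≤ _
      rw [e2]
      exact tri _ _ _ (pr _ _ (ent _ _) (q1 _)) (pr _ _ (ent _ _) (q1 _)) (pr _ _ (ent _ _) (q1 _))
  · push Not at h2
    obtain ⟨r, hr⟩ : ∃ r, r = w 2 / g 2 2 := ⟨_, rfl⟩
    obtain ⟨y0, hy0⟩ : ∃ y, y = w 0 - r * g 0 2 := ⟨_, rfl⟩
    obtain ⟨y1, hy1⟩ : ∃ y, y = w 1 - r * g 1 2 := ⟨_, rfl⟩
    have hw2 : w 2 = r * g 2 2 := by rw [hr]; field_simp
    have b0 : |y0| ≤ C := by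
      have := q1 2
      rw [hw2, show w 0 * g 2 2 - r * g 2 2 * g 0 2 = y0 * g 2 2 by rw [hy0]; ring, abs_mul,
        abs_of_pos hT0] at this
      exact le_of_mul_le_mul_right this hT0
    have b1 : |y1| ≤ C := by
      have := q0 2
      rw [hw2, show w 1 * g 2 2 - r * g 2 2 * g 1 2 = y1 * g 2 2 by rw [hy1]; ring, abs_mul,
        abs_of_pos hT0] at this
      exact le_of_mul_le_mul_right this hT0
    have main (i : Fin 3) (z : ℝ) (hz : z = g 1 2 * g 0 i - g 0 2 * g 1 i) :
        |r| * |z| ≤ 3 * C * g 2 2 := by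
      have e : r * z = (w 1 * g 0 i - w 0 * g 1 i) - y1 * g 0 i + y0 * g 1 i := by
        rw [hy0, hy1, hz]; ring
      rw [← abs_mul, e]
      have t1 : |y1 * g 0 i| ≤ C * g 2 2 := by
        rw [abs_mul]; exact mul_le_mul b1 (ent _ _) (abs_nonneg _) hC
      have t2 : |y0 * g 1 i| ≤ C * g 2 2 := by
        rw [abs_mul]; exact mul_le_mul b0 (ent _ _) (abs_nonneg _) hC
      have t3 := q2 i
      rw [abs_le] at *
      constructor <;> linarith [t1.1, t1.2, t2.1, t2.2, t3.1, t3.2]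
    have br : |r| ≤ 6 * C := by
      have m0 := main 0 (g 2 1) (by linarith [h.k21])
      have m1 := main 1 (- g 2 0) (by linarith [h.k20])
      rw [abs_neg] at m1
      have : g 2 2 / 2 ≤ |g 2 1| ∨ g 2 2 / 2 ≤ |g 2 0| := by
        by_contra hcon
        push Not at hcon
        have a1 : g 2 1 ^ 2 < (g 2 2 / 2) ^ 2 := sq_lt_sq' (by linarith [(abs_lt.mp hcon.1).1]) (abs_lt.mp hcon.1).2
        have a2 : g 2 0 ^ 2 < (g 2 2 / 2) ^ 2 := sq_lt_sq' (by linarith [(abs_lt.mp hcon.2).1]) (abs_lt.mp hcon.2).2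
        nlinarith [h.r22]
      have fin (z : ℝ) (hz : g 2 2 / 2 ≤ |z|) (hm : |r| * |z| ≤ 3 * C * g 2 2) : |r| ≤ 6 * C := by
        have : |r| * (g 2 2 / 2) ≤ 6 * C * (g 2 2 / 2) := by
          calc _ ≤ |r| * |z| := by gcongr
            _ ≤ _ := by linarith
        exact le_of_mul_le_mul_right this (by linarith)
      rcases this with h | h
      · exact fin _ h m0
      · exact fin _ h m1
    refine ⟨![0, 0, r], ![y0, y1, 0], ?_, ?_, ?_⟩
    · rw [pi_norm_le_iff_of_nonneg (by positivity)]
      intro i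
      fin_cases i <;> simp <;> linarith
    · rw [pi_norm_le_iff_of_nonneg (by positivity)]
      intro i
      fin_cases i <;> simp <;> linarith
    · ext i
      fin_cases i <;> simp [Matrix.mulVec, dotProduct, Fin.sum_univ_three]
      · rw [hy0]; ring
      · rw [hy1]; ring
      · rw [hw2]; ring

lemma B_le (v w : Fin 3 → ℝ) : |Bform v w| ≤ 3 * (‖v‖ * ‖w‖) := by
  have h (i : Fin 3) : |v i * w i| ≤ ‖v‖ * ‖w‖ := by
    rw [abs_mul]
    exact mul_le_mul (norm_le_pi_norm v i) (norm_le_pi_norm w i) (abs_nonneg _) (norm_nonneg _)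
  have h0 := abs_le.mp (h 0)
  have h1 := abs_le.mp (h 1)
  have h2 := abs_le.mp (h 2)
  simp only [Bform]
  rw [abs_le]
  constructor <;> linarith [h0.1, h0.2, h1.1, h1.2, h2.1, h2.2]

lemma mulVec_le (m : M3) : ∃ c : ℝ, 0 ≤ c ∧ ∀ v, ‖m.mulVec v‖ ≤ c * ‖v‖ := by
  let L : (Fin 3 → ℝ) →L[ℝ] (Fin 3 → ℝ) := LinearMap.toContinuousLinearMap (Matrix.mulVecLin m)
  exact ⟨‖L‖, norm_nonneg _, fun v => L.le_opNorm v⟩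

lemma xi_le (m : M3) : ∃ c : ℝ, 0 ≤ c ∧ ∀ g : M3, LRel g → ‖xi (g * m)‖ ≤ c * g 2 2 := by
  refine ⟨2 * ∑ i, ∑ j, |m i j|, by positivity, fun g h => ?_⟩
  have hT := h.T1
  have e (i j : Fin 3) : |(g * m) i j| ≤ (∑ i, ∑ j, |m i j|) * g 2 2 := by
    rw [Matrix.mul_apply, Finset.sum_mul]
    refine (Finset.abs_sum_le_sum_abs _ _).trans (Finset.sum_le_sum fun k _ => ?_)
    rw [abs_mul, mul_comm]
    exact mul_le_mul (Finset.single_le_sum (f := fun j => |m k j|) (fun _ _ => abs_nonneg _)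
      (Finset.mem_univ j)) (entry_le h i k) (abs_nonneg _) (by positivity)
  rw [pi_norm_le_iff_of_nonneg (by positivity)]
  intro i
  have f (i j : Fin 3) := abs_le.mp (e i j)
  rw [Real.norm_eq_abs, abs_le]
  fin_cases i <;> simp [xi] <;> constructor <;>
    linarith [(f 2 1).1, (f 2 1).2, (f 1 2).1, (f 1 2).2, (f 0 2).1, (f 0 2).2, (f 2 0).1,
      (f 2 0).2, (f 1 0).1, (f 1 0).2, (f 0 1).1, (f 0 1).2]

lemma B_add (v w z : Fin 3 → ℝ) : Bform (v + w) z = Bform v z + Bform w z := by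
  simp only [Bform, Pi.add_apply]; ring
lemma B_add' (v w z : Fin 3 → ℝ) : Bform z (v + w) = Bform z v + Bform z w := by
  simp only [Bform, Pi.add_apply]; ring
lemma B_smul (c : ℝ) (v z : Fin 3 → ℝ) : Bform (c • v) z = c * Bform v z := by
  simp only [Bform, Pi.smul_apply, smul_eq_mul]; ring
lemma B_smul' (c : ℝ) (v z : Fin 3 → ℝ) : Bform z (c • v) = c * Bform z v := by
  simp only [Bform, Pi.smul_apply, smul_eq_mul]; ring
lemma xi_add (m n : M3) : xi (m + n) = xi m + xi n := by
  ext i; fin_cases i <;> simp [xi] <;> ring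
lemma xi_smul (c : ℝ) (m : M3) : xi (c • m) = c • xi m := by
  ext i; fin_cases i <;> simp [xi] <;> ring

lemma pos_xi {Γ₀ : Subgroup M3ˣ} (hS : IsSchottky Γ₀) (u : Γ₀ → Fin 3 → ℝ)
    (hpos : ∀ γ : Γ₀, γ ≠ 1 → ∀ x0 : Fin 3 → ℝ, IsNeutral (toM γ) x0 → 0 < Bform (u γ) x0)
    (g : Γ₀) : 0 ≤ Bform (u g) (xi (toM g)) := by
  by_cases hg : g = 1
  · rw [hg, toM_one]; simp [xi, Bform]
  · obtain ⟨r, hr, hn⟩ := neutral (hS.1 g) (hS.2.2.2 g hg)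
    have := hpos g hg _ hn
    rw [B_smul'] at this
    exact (pos_of_mul_pos_right this hr.le).le

/-- positive linear combinations of properly discontinuous affine
deformations with positive Margulis invariant are properly discontinuous: the proper
deformations with positive invariant form a convex cone in the space of cocycles. -/
theorem stmt_14 (Γ₀ : Subgroup (Matrix (Fin 3) (Fin 3) ℝ)ˣ) (hS : IsSchottky Γ₀)
    (u₁ u₂ : Γ₀ → Fin 3 → ℝ) (hu₁ : IsCocycle Γ₀ u₁) (hu₂ : IsCocycle Γ₀ u₂)
    (hPD₁ : ProperlyDisc Γ₀ u₁) (hPD₂ : ProperlyDisc Γ₀ u₂)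
    (hpos₁ : ∀ γ : Γ₀, γ ≠ 1 → ∀ x0 : Fin 3 → ℝ, IsNeutral (toM γ) x0 → 0 < Bform (u₁ γ) x0)
    (hpos₂ : ∀ γ : Γ₀, γ ≠ 1 → ∀ x0 : Fin 3 → ℝ, IsNeutral (toM γ) x0 → 0 < Bform (u₂ γ) x0) :
    ∀ s t : ℝ, 0 < s → 0 < t → ProperlyDisc Γ₀ (fun γ => s • u₁ γ + t • u₂ γ) := by
  intro s t hs ht K hK
  obtain ⟨R, hR⟩ := hK.isBounded.exists_norm_le
  have hso := hS.1
  have hrel (g : Γ₀) := so_rel (hso g)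
  -- lower bounds
  have low (u : Γ₀ → Fin 3 → ℝ) (hu : IsCocycle Γ₀ u)
      (hpos : ∀ γ : Γ₀, γ ≠ 1 → ∀ x0 : Fin 3 → ℝ, IsNeutral (toM γ) x0 → 0 < Bform (u γ) x0)
      (h : Γ₀) : ∃ C : ℝ, ∀ g : Γ₀, - (C * toM g 2 2) ≤ Bform (u g) (xi (toM g * toM h)) := by
    obtain ⟨c, hc, hxi⟩ := xi_le (toM h)
    obtain ⟨d, hd, hmv⟩ := mulVec_le (toM h)
    refine ⟨3 * (‖u h‖ * (d * c)), fun g => ?_⟩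
    have h1 := pos_xi hS u hpos (g * h)
    have hfix := xi_fix (hrel (g * h))
    rw [hu g h, B_add] at h1
    rw [toM_mul] at h1 hfix
    set z := xi (toM g * toM h) with hz
    have h2 : Bform ((toM g).mulVec (u h)) z = Bform (u h) ((toM h).mulVec z) := by
      conv_lhs => rw [← hfix, ← Matrix.mulVec_mulVec]
      exact (hso g).1 _ _
    rw [h2] at h1
    have h3 := (abs_le.mp (B_le (u h) ((toM h).mulVec z))).2
    have h4 : ‖(toM h).mulVec z‖ ≤ d * (c * toM g 2 2) :=
      (hmv z).trans (mul_le_mul_of_nonneg_left (hxi _ (hrel g)) hd)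
    have h5 : ‖u h‖ * ‖(toM h).mulVec z‖ ≤ ‖u h‖ * (d * (c * toM g 2 2)) :=
      mul_le_mul_of_nonneg_left h4 (norm_nonneg _)
    linarith
  have bd (m : M3) (hm : m ∈ Submodule.span ℝ (Set.range fun g : Γ₀ => toM g)) :
      ∃ C : ℝ, ∀ g : Γ₀, (∃ x ∈ K, (toM g).mulVec x + (s • u₁ g + t • u₂ g) ∈ K) →
        |Bform (u₁ g) (xi (toM g * m))| ≤ C * toM g 2 2 := by
    induction hm using Submodule.span_induction with
    | zero => exact ⟨0, fun g _ => by simp [xi, Bform]⟩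
    | add x y _ _ h1 h2 =>
      obtain ⟨C, hC⟩ := h1
      obtain ⟨D, hD⟩ := h2
      refine ⟨C + D, fun g hg => ?_⟩
      rw [mul_add, xi_add, B_add', add_mul]
      exact (abs_add_le _ _).trans (add_le_add (hC g hg) (hD g hg))
    | smul c x _ h =>
      obtain ⟨C, hC⟩ := h
      refine ⟨|c| * C, fun g hg => ?_⟩
      rw [Matrix.mul_smul, xi_smul, B_smul', abs_mul, mul_assoc]
      exact mul_le_mul_of_nonneg_left (hC g hg) (abs_nonneg _)
    | mem x hx =>
      obtain ⟨h, rfl⟩ := hx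
      obtain ⟨C₁, hC₁⟩ := low u₁ hu₁ hpos₁ h
      obtain ⟨C₂, hC₂⟩ := low u₂ hu₂ hpos₂ h
      obtain ⟨c, hc, hxi⟩ := xi_le (toM h)
      obtain ⟨d, hd, hmv⟩ := mulVec_le (toM h)
      refine ⟨max C₁ ((3 * (R * c) + 3 * (R * (d * c)) + t * C₂) / s), ?_⟩
      rintro g ⟨x, hx, hy⟩
      have hT : 0 < toM g 2 2 := by linarith [(hrel g).T1]
      have l1 := hC₁ g
      have l2 := hC₂ g
      have hfix := xi_fix (hrel (g * h))
      rw [toM_mul] at hfix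
      have hz1 := hxi _ (hrel g)
      simp only at l1 l2 ⊢
      set z := xi (toM g * toM h) with hz
      set y := (toM g).mulVec x + (s • u₁ g + t • u₂ g) with hydef
      have e1 : Bform y z = Bform x ((toM h).mulVec z) + (s * Bform (u₁ g) z + t * Bform (u₂ g) z) := by
        rw [hydef, B_add, B_add, B_smul, B_smul]
        congr 1
        conv_lhs => rw [← hfix, ← Matrix.mulVec_mulVec]
        exact (hso g).1 _ _
      have hR0 : 0 ≤ R := (norm_nonneg x).trans (hR x hx)
      have b1 : Bform y z ≤ 3 * (R * (c * toM g 2 2)) := by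
        refine ((abs_le.mp (B_le y z)).2).trans ?_
        have := mul_le_mul (hR y hy) hz1 (norm_nonneg _) hR0
        linarith
      have b2 : - (3 * (R * (d * (c * toM g 2 2)))) ≤ Bform x ((toM h).mulVec z) := by
        refine le_trans ?_ ((abs_le.mp (B_le x ((toM h).mulVec z))).1)
        have h4 : ‖(toM h).mulVec z‖ ≤ d * (c * toM g 2 2) :=
          (hmv z).trans (mul_le_mul_of_nonneg_left hz1 hd)
        have := mul_le_mul (hR x hx) h4 (norm_nonneg _) hR0
        linarith
      have b3 := mul_le_mul_of_nonneg_left l2 ht.le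
      have b4 : Bform (u₁ g) z ≤ ((3 * (R * c) + 3 * (R * (d * c)) + t * C₂) / s) * toM g 2 2 := by
        rw [div_mul_eq_mul_div, le_div_iff₀ hs]
        linarith
      rw [abs_le]
      constructor
      · have := mul_le_mul_of_nonneg_right
          (le_max_left C₁ ((3 * (R * c) + 3 * (R * (d * c)) + t * C₂) / s)) hT.le
        linarith
      · have := mul_le_mul_of_nonneg_right
          (le_max_right C₁ ((3 * (R * c) + 3 * (R * (d * c)) + t * C₂) / s)) hT.le
        linarith
  choose Cf hCf using fun p : Fin 3 × Fin 3 => bd _ (single_mem hS p.1 p.2)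
  let C := ∑ p, |Cf p|
  have hC0 : 0 ≤ C := Finset.sum_nonneg fun _ _ => abs_nonneg _
  refine (hPD₁ (Metric.closedBall 0 (12 * C)) (isCompact_closedBall _ _)).subset ?_
  intro g hg
  have hT : 0 < toM g 2 2 := by linarith [(hrel g).T1]
  obtain ⟨x, y, hx, hy, hw⟩ := lin_bound (hrel g) (u₁ g) C hC0 (fun i j => by
    refine (hCf (i, j) g hg).trans (mul_le_mul_of_nonneg_right ?_ hT.le)
    exact (le_abs_self _).trans
      (Finset.single_le_sum (f := fun p => |Cf p|) (fun _ _ => abs_nonneg _) (Finset.mem_univ (i, j))))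
  refine ⟨-x, by simpa using hx, ?_⟩
  rw [hw, Matrix.mulVec_neg, neg_add_cancel_comm_assoc]
  simpa using hy

end
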